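/- arXiv:2008.08539 — 2 statements merged into one kernel-verified Lean document; each statement's English description precedes it below -/
import Mathlib

section
/- Let 0 < p ≤ q with p < 1. Then for θ ∈ [0,1) the Assouad spectrum of S_{p,q} is given by: dim_A^θ S_{p,q} = (2+q−p)/((1+q)(1−θ)) if 0 ≤ θ < p/(1+q); dim_A^θ S_{p,q} = (2+q−θ(1+q))/((1+q)(1−θ)) if p/(1+q) ≤ θ < q/(1+q); and dim_A^θ S_{p,q} = 2 if q/(1+q) ≤ θ < 1. -/
open Set Metric MeasureTheory

noncomputable def spiral (p q : ℝ) : Set ℂ :=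
  {z : ℂ | ∃ t : ℝ, 1 < t ∧
    z = (t ^ (-p) * Real.cos t : ℝ) + (t ^ (-q) * Real.sin t : ℝ) * Complex.I}

/-- An axes-oriented closed square of sidelength `r` with bottom-left corner `c`. -/
def closedSquare (c : ℝ × ℝ) (r : ℝ) : Set ℂ :=
  {z : ℂ | z.re ∈ Set.Icc c.1 (c.1 + r) ∧ z.im ∈ Set.Icc c.2 (c.2 + r)}

/-- The smallest number of squares of sidelength `r` needed to cover `E`. -/
noncomputable def sqCoverNum (E : Set ℂ) (r : ℝ) : ℕ :=
  sInf {n : ℕ | ∃ c : Fin n → ℝ × ℝ, E ⊆ ⋃ i, closedSquare (c i) r}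

/-- The Assouad spectrum of `F ⊆ ℂ` at `θ`. -/
noncomputable def assouadSpectrum (θ : ℝ) (F : Set ℂ) : ℝ :=
  sInf {α : ℝ | 0 ≤ α ∧ ∃ C : ℝ, 0 < C ∧ ∀ r : ℝ, 0 < r → r < 1 → ∀ x ∈ F,
    (sqCoverNum (Metric.ball x (r ^ θ) ∩ F) r : ℝ) ≤ C * (r ^ θ / r) ^ α}

/-- `E` can be covered by at most `M` squares of sidelength `r`. -/
def CoveredBy (E : Set ℂ) (r M : ℝ) : Prop :=
  ∃ s : Finset (ℝ × ℝ), E ⊆ ⋃ c ∈ s, closedSquare c r ∧ (s.card : ℝ) ≤ M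

lemma CoveredBy.mono {E F : Set ℂ} {r M N : ℝ} (h : CoveredBy F r M) (hEF : E ⊆ F)
    (hMN : M ≤ N) : CoveredBy E r N := by
  obtain ⟨s, hs, hc⟩ := h
  exact ⟨s, hEF.trans hs, hc.trans hMN⟩

lemma CoveredBy.union {E F : Set ℂ} {r M N : ℝ} (hE : CoveredBy E r M) (hF : CoveredBy F r N) :
    CoveredBy (E ∪ F) r (M + N) := by
  classical
  obtain ⟨s, hs, hc⟩ := hE
  obtain ⟨t, ht, hd⟩ := hF
  refine ⟨s ∪ t, ?_, ?_⟩
  · rw [Finset.set_biUnion_union]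
    exact Set.union_subset_union hs ht
  · have : ((s ∪ t).card : ℝ) ≤ s.card + t.card := by exact_mod_cast Finset.card_union_le s t
    linarith

lemma CoveredBy.biUnion {ι : Type*} (J : Finset ι) {E : ι → Set ℂ} {r : ℝ} {M : ι → ℝ}
    (h : ∀ i ∈ J, CoveredBy (E i) r (M i)) : CoveredBy (⋃ i ∈ J, E i) r (∑ i ∈ J, M i) := by
  classical
  induction J using Finset.induction_on with
  | empty => exact ⟨∅, by simp, by simp⟩
  | insert i J hi ih =>
    rw [Finset.set_biUnion_insert, Finset.sum_insert hi]
    exact (h i (Finset.mem_insert_self i J)).union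
      (ih fun j hj => h j (Finset.mem_insert_of_mem hj))

lemma CoveredBy.exists_fin {E : Set ℂ} {r M : ℝ} (h : CoveredBy E r M) :
    ∃ n : ℕ, (n : ℝ) ≤ M ∧ ∃ c : Fin n → ℝ × ℝ, E ⊆ ⋃ i, closedSquare (c i) r := by
  obtain ⟨s, hs, hc⟩ := h
  refine ⟨s.card, hc, fun i => (s.equivFin.symm i : ℝ × ℝ), hs.trans ?_⟩
  refine Set.iUnion₂_subset fun c hcs => ?_
  refine Set.subset_iUnion_of_subset (s.equivFin ⟨c, hcs⟩) ?_
  simp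

lemma CoveredBy.sqCoverNum_le {E : Set ℂ} {r M : ℝ} (h : CoveredBy E r M) :
    (sqCoverNum E r : ℝ) ≤ M := by
  obtain ⟨n, hn, hc⟩ := h.exists_fin
  exact le_trans (by exact_mod_cast Nat.sInf_le hc) hn

lemma exists_closedSquare_of_forall_abs_sub_le {E : Set ℂ} {r : ℝ}
    (h : ∀ z ∈ E, ∀ w ∈ E, |z.re - w.re| ≤ r ∧ |z.im - w.im| ≤ r) :
    ∃ c, E ⊆ closedSquare c r := by
  rcases E.eq_empty_or_nonempty with rfl | hne
  · exact ⟨0, by simp⟩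
  have key : ∀ f : ℂ → ℝ, (∀ z ∈ E, ∀ w ∈ E, |f z - f w| ≤ r) →
      ∀ z ∈ E, f z ∈ Set.Icc (sInf (f '' E)) (sInf (f '' E) + r) := by
    intro f hf z hz
    constructor
    · refine csInf_le ⟨f z - r, ?_⟩ (Set.mem_image_of_mem f hz)
      rintro _ ⟨w, hw, rfl⟩
      linarith [(abs_le.1 (hf z hz w hw)).2]
    · rw [← sub_le_iff_le_add]
      refine le_csInf (hne.image f) ?_
      rintro _ ⟨w, hw, rfl⟩
      linarith [(abs_le.1 (hf z hz w hw)).2]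
  exact ⟨(sInf (Complex.re '' E), sInf (Complex.im '' E)), fun z hz =>
    ⟨key Complex.re (fun z hz w hw => (h z hz w hw).1) z hz,
      key Complex.im (fun z hz w hw => (h z hz w hw).2) z hz⟩⟩

/-- A parametrized set is covered by one square for each label, provided that points with the
same label are `r`-close in both coordinates. -/
lemma coveredBy_image_of_label {τ ι : Type*} {S : Set τ} {γ : τ → ℂ} {r : ℝ} (label : τ → ι)
    (J : Finset ι) (hJ : ∀ t ∈ S, label t ∈ J)
    (h : ∀ s ∈ S, ∀ t ∈ S, label s = label t →
      |(γ s).re - (γ t).re| ≤ r ∧ |(γ s).im - (γ t).im| ≤ r) :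
    CoveredBy (γ '' S) r J.card := by
  classical
  have hsq : ∀ j : ι, ∃ c, γ '' {t ∈ S | label t = j} ⊆ closedSquare c r := by
    intro j
    apply exists_closedSquare_of_forall_abs_sub_le
    rintro _ ⟨s, ⟨hs, hsj⟩, rfl⟩ _ ⟨t, ⟨ht, htj⟩, rfl⟩
    exact h s hs t ht (hsj.trans htj.symm)
  choose c hc using hsq
  refine ⟨J.image c, ?_, by exact_mod_cast Finset.card_image_le⟩
  rintro _ ⟨t, ht, rfl⟩
  refine Set.mem_iUnion₂.2 ⟨c (label t), Finset.mem_image_of_mem c (hJ t ht), ?_⟩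
  exact hc _ ⟨t, ⟨ht, rfl⟩, rfl⟩

lemma abs_sub_le_of_floor_div_eq {a b r : ℝ} (hr : 0 < r) (h : ⌊a / r⌋ = ⌊b / r⌋) :
    |a - b| ≤ r := by
  have h1 := Int.abs_sub_lt_one_of_floor_eq_floor h
  rw [← sub_div, abs_div, abs_of_pos hr, div_lt_one hr] at h1
  exact h1.le

lemma card_Icc_floor_le {a b : ℝ} (hab : a ≤ b) :
    ((Finset.Icc ⌊a⌋ ⌊b⌋).card : ℝ) ≤ b - a + 2 := by
  have h1 : ⌊a⌋ ≤ ⌊b⌋ := Int.floor_mono hab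
  have h2 : ((Finset.Icc ⌊a⌋ ⌊b⌋).card : ℤ) = ⌊b⌋ + 1 - ⌊a⌋ :=
    Int.card_Icc_of_le _ _ (by lia)
  have h3 : ((Finset.Icc ⌊a⌋ ⌊b⌋).card : ℝ) = ⌊b⌋ + 1 - ⌊a⌋ := by exact_mod_cast h2
  rw [h3]
  linarith [Int.floor_le b, Int.lt_floor_add_one a]

lemma coveredBy_box {c : ℝ × ℝ} {a b r : ℝ} (hr : 0 < r) (ha : r ≤ a) (hb : r ≤ b) :
    CoveredBy {z : ℂ | |z.re - c.1| ≤ a ∧ |z.im - c.2| ≤ b} r (16 * (a * b / r ^ 2)) := by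
  have h := coveredBy_image_of_label (γ := id) (r := r)
    (S := {z : ℂ | |z.re - c.1| ≤ a ∧ |z.im - c.2| ≤ b})
    (fun z : ℂ => (⌊z.re / r⌋, ⌊z.im / r⌋))
    (Finset.Icc ⌊(c.1 - a) / r⌋ ⌊(c.1 + a) / r⌋ ×ˢ Finset.Icc ⌊(c.2 - b) / r⌋ ⌊(c.2 + b) / r⌋)
    ?_ ?_
  · refine h.mono (by simp) ?_
    rw [Finset.card_product]
    push_cast
    have key : ∀ x d : ℝ, r ≤ d →
        ((Finset.Icc ⌊(x - d) / r⌋ ⌊(x + d) / r⌋).card : ℝ) ≤ 4 * (d / r) := by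
      intro x d hd
      have h1 : 1 ≤ d / r := (one_le_div hr).2 hd
      have h2 : (x - d) / r ≤ (x + d) / r := by gcongr; linarith
      refine (card_Icc_floor_le h2).trans ?_
      have h3 : (x + d) / r - (x - d) / r = 2 * (d / r) := by ring
      linarith
    calc _ ≤ (4 * (a / r)) * (4 * (b / r)) := by
          have : 0 ≤ a / r := div_nonneg (hr.le.trans ha) hr.le
          exact mul_le_mul (key _ _ ha) (key _ _ hb) (by positivity) (by positivity)
      _ = _ := by ring
  · rintro z ⟨h1, h2⟩
    rw [abs_le] at h1 h2
    simp only [Finset.mem_product, Finset.mem_Icc]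
    refine ⟨⟨?_, ?_⟩, ?_, ?_⟩ <;> apply Int.floor_mono <;> gcongr <;> linarith
  · intro s _ t _ hst
    simp only [Prod.mk.injEq] at hst
    exact ⟨abs_sub_le_of_floor_div_eq hr hst.1, abs_sub_le_of_floor_div_eq hr hst.2⟩

/-- The phase of the derivative of `t ↦ t ^ (-a) * cos (t - φ)`. -/
noncomputable def phase (a φ t : ℝ) : ℝ := t - φ + Real.arctan (a / t)

lemma mul_sin_add_mul_cos_eq_sin_phase (a φ : ℝ) {t : ℝ} (ht : 0 < t) :
    t * Real.sin (t - φ) + a * Real.cos (t - φ) =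
      t * √(1 + (a / t) ^ 2) * Real.sin (phase a φ t) := by
  have h : 0 < √(1 + (a / t) ^ 2) := by positivity
  rw [phase, Real.sin_add, Real.sin_arctan, Real.cos_arctan]
  field_simp

lemma monotoneOn_phase {a : ℝ} (ha : 0 < a) (φ : ℝ) : MonotoneOn (phase a φ) (Set.Ioi 1) := by
  have hd : ∀ t ∈ Set.Ioi (1 : ℝ), HasDerivAt (phase a φ)
      (1 + 1 / (1 + (a / t) ^ 2) * (a * (-(t ^ 2)⁻¹))) t := by
    intro t ht
    have ht0 : t ≠ 0 := (zero_lt_one.trans ht).ne'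
    exact ((hasDerivAt_id t).sub_const φ).add (((hasDerivAt_inv ht0).const_mul a).arctan)
  refine monotoneOn_of_deriv_nonneg (convex_Ioi 1)
    (fun t ht => (hd t ht).continuousAt.continuousWithinAt)
    (fun t ht => (hd t (interior_subset ht)).differentiableAt.differentiableWithinAt) ?_
  intro t ht
  rw [interior_Ioi] at ht
  rw [(hd t ht).deriv]
  have ht1 : 1 < t := ht
  have ht0 : 0 < t := by linarith
  have h1 : 1 + 1 / (1 + (a / t) ^ 2) * (a * (-(t ^ 2)⁻¹)) =
      (t ^ 2 + a ^ 2 - a) / (t ^ 2 + a ^ 2) := by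
    field_simp
    ring
  rw [h1]
  apply div_nonneg _ (by positivity)
  nlinarith [sq_nonneg (a - 1), sq_nonneg a]

lemma hasDerivAt_rpow_neg_mul_cos (a φ : ℝ) {t : ℝ} (ht : 0 < t) :
    HasDerivAt (fun t : ℝ => t ^ (-a) * Real.cos (t - φ))
      (-(t ^ (-a) * √(1 + (a / t) ^ 2) * Real.sin (phase a φ t))) t := by
  have h1 : HasDerivAt (fun t : ℝ => t ^ (-a)) (-a * t ^ (-a - 1)) t :=
    Real.hasDerivAt_rpow_const (Or.inl ht.ne')
  have h2 : HasDerivAt (fun t : ℝ => Real.cos (t - φ)) (-Real.sin (t - φ) * 1) t :=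
    ((hasDerivAt_id t).sub_const φ).cos
  refine (h1.mul h2).congr_deriv ?_
  have h3 := mul_sin_add_mul_cos_eq_sin_phase a φ ht
  have h4 : t ^ (-a) = t * t ^ (-a - 1) := by
    rw [Real.rpow_sub_one ht.ne']
    field_simp
  rw [h4]
  linear_combination (-t ^ (-a - 1)) * h3

/-- On a parameter interval on which `⌊phase / π⌋` is constant, the function
`t ↦ t ^ (-a) * cos (t - φ)` is monotone or antitone, according to the parity of that constant. -/
lemma rpow_neg_mul_cos_anti {a : ℝ} (ha : 0 < a) (φ : ℝ) {s t : ℝ} (hs : 1 < s) (hst : s ≤ t)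
    (h : ⌊phase a φ s / Real.pi⌋ = ⌊phase a φ t / Real.pi⌋) :
    (-1) ^ ⌊phase a φ t / Real.pi⌋ * (t ^ (-a) * Real.cos (t - φ)) ≤
      (-1) ^ ⌊phase a φ t / Real.pi⌋ * (s ^ (-a) * Real.cos (s - φ)) := by
  set k := ⌊phase a φ t / Real.pi⌋ with hk
  have hd : ∀ u ∈ Set.Icc s t, HasDerivAt
      (fun t : ℝ => (-1 : ℝ) ^ k * (t ^ (-a) * Real.cos (t - φ)))
      ((-1) ^ k * (-(u ^ (-a) * √(1 + (a / u) ^ 2) * Real.sin (phase a φ u)))) u := fun u hu =>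
    (hasDerivAt_rpow_neg_mul_cos a φ (by linarith [hu.1])).const_mul _
  have hanti := antitoneOn_of_deriv_nonpos (convex_Icc s t)
    (fun u hu => (hd u hu).continuousAt.continuousWithinAt)
    (fun u hu => (hd u (interior_subset hu)).differentiableAt.differentiableWithinAt) (by
      intro u hu
      have hu' := interior_subset hu
      rw [(hd u hu').deriv]
      have hu1 : 1 < u := by linarith [hu'.1]
      have m1 := monotoneOn_phase ha φ hs hu1 hu'.1
      have m2 := monotoneOn_phase ha φ hu1 (hs.trans_le hst) hu'.2
      have hsin : 0 ≤ (-1 : ℝ) ^ k * Real.sin (phase a φ u) := by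
        rw [← Real.sin_sub_int_mul_pi]
        have f1 := Int.floor_le (phase a φ s / Real.pi)
        have f2 := Int.lt_floor_add_one (phase a φ t / Real.pi)
        rw [h, le_div_iff₀ Real.pi_pos] at f1
        rw [← hk, div_lt_iff₀ Real.pi_pos] at f2
        apply Real.sin_nonneg_of_nonneg_of_le_pi <;> linarith
      have hpos : 0 ≤ u ^ (-a) * √(1 + (a / u) ^ 2) := by positivity
      nlinarith [mul_nonneg hpos hsin])
  exact hanti ⟨le_rfl, hst⟩ ⟨hst, le_rfl⟩ hst

lemma floor_phase_div_pi_mem {a φ t : ℝ} (ha : 0 < a) {n : ℝ} (hn : 0 < n) (h1 : n ≤ t)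
    (h2 : t ≤ n + 1) :
    ⌊phase a φ t / Real.pi⌋ ∈
      Finset.Icc ⌊(n - φ) / Real.pi⌋ (⌊(n - φ) / Real.pi⌋ + 1) := by
  have hpi := Real.pi_gt_three
  have hat : 0 < Real.arctan (a / t) := Real.arctan_pos.2 (div_pos ha (hn.trans_le h1))
  have hat' := Real.arctan_lt_pi_div_two (a / t)
  rw [Finset.mem_Icc]
  constructor
  · apply Int.floor_mono
    gcongr
    rw [phase]
    linarith
  · rw [← Int.floor_add_one]
    apply Int.floor_mono
    rw [div_add_one Real.pi_ne_zero]
    gcongr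
    rw [phase]
    linarith

/-- The standard parametrization of the elliptical polynomial spiral. -/
noncomputable def spiralPoint (p q t : ℝ) : ℂ :=
  (t ^ (-p) * Real.cos t : ℝ) + (t ^ (-q) * Real.sin t : ℝ) * Complex.I

@[simp]
lemma spiralPoint_re (p q t : ℝ) : (spiralPoint p q t).re = t ^ (-p) * Real.cos t := by
  simp only [spiralPoint, Complex.add_re, Complex.re_ofReal_mul, Complex.ofReal_re, Complex.I_re,
    mul_zero, add_zero]

@[simp]
lemma spiralPoint_im (p q t : ℝ) : (spiralPoint p q t).im = t ^ (-q) * Real.sin t := by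
  simp only [spiralPoint, Complex.add_im, Complex.im_ofReal_mul, Complex.ofReal_im, Complex.I_im,
    mul_one, zero_add]

lemma mem_spiral_iff {p q : ℝ} {z : ℂ} : z ∈ spiral p q ↔ ∃ t, 1 < t ∧ spiralPoint p q t = z :=
  ⟨fun ⟨t, ht, h⟩ => ⟨t, ht, h.symm⟩, fun ⟨t, ht, h⟩ => ⟨t, ht, h.symm⟩⟩

lemma abs_spiralPoint_re_le {p : ℝ} (q : ℝ) {m t : ℝ} (hp : 0 < p) (hm : 0 < m) (hmt : m ≤ t) :
    |(spiralPoint p q t).re| ≤ m ^ (-p) := by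
  have ht : 0 < t := hm.trans_le hmt
  rw [spiralPoint_re, abs_mul, abs_of_nonneg (by positivity)]
  calc t ^ (-p) * |Real.cos t| ≤ t ^ (-p) * 1 := by
        gcongr
        exact Real.abs_cos_le_one t
    _ = t ^ (-p) := mul_one _
    _ ≤ m ^ (-p) := Real.rpow_le_rpow_of_nonpos hm hmt (by linarith)

lemma abs_spiralPoint_im_le (p : ℝ) {q m t : ℝ} (hq : 0 < q) (hm : 0 < m) (hmt : m ≤ t) :
    |(spiralPoint p q t).im| ≤ m ^ (-q) := by
  have ht : 0 < t := hm.trans_le hmt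
  rw [spiralPoint_im, abs_mul, abs_of_nonneg (by positivity)]
  calc t ^ (-q) * |Real.sin t| ≤ t ^ (-q) * 1 := by
        gcongr
        exact Real.abs_sin_le_one t
    _ = t ^ (-q) := mul_one _
    _ ≤ m ^ (-q) := Real.rpow_le_rpow_of_nonpos hm hmt (by linarith)

lemma abs_neg_one_zpow_mul (k : ℤ) (x : ℝ) : |(-1) ^ k * x| = |x| := by
  rcases Int.even_or_odd k with h | h
  · simp [h.neg_one_zpow]
  · simp [h.neg_one_zpow]

/-- A bounded number of turns of the spiral, restricted to a box of side `2 * ρ`, is covered by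
`O(ρ / r + 1)` squares. -/
lemma coveredBy_arc {p q : ℝ} (hp : 0 < p) (hq : 0 < q) {n r ρ : ℝ} (hn : 1 ≤ n) (hr : 0 < r)
    (hρ : 0 ≤ ρ) (c : ℝ × ℝ) :
    CoveredBy (spiralPoint p q '' {t | 1 < t ∧ n ≤ t ∧ t ≤ n + 1 ∧
      |(spiralPoint p q t).re - c.1| ≤ ρ ∧ |(spiralPoint p q t).im - c.2| ≤ ρ}) r
      (16 * (ρ / r) + 8) := by
  have hn0 : 0 < n := by linarith
  set k : ℝ → ℤ := fun t => ⌊phase p 0 t / Real.pi⌋ with hk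
  set l : ℝ → ℤ := fun t => ⌊phase q (Real.pi / 2) t / Real.pi⌋ with hl
  set g : ℝ → ℝ := fun t => (-1) ^ k t * ((spiralPoint p q t).re - c.1) +
    (-1) ^ l t * ((spiralPoint p q t).im - c.2) with hg
  refine (coveredBy_image_of_label (fun t => (k t, l t, ⌊g t / r⌋))
    (Finset.Icc ⌊(n - 0) / Real.pi⌋ (⌊(n - 0) / Real.pi⌋ + 1) ×ˢ
      Finset.Icc ⌊(n - Real.pi / 2) / Real.pi⌋ (⌊(n - Real.pi / 2) / Real.pi⌋ + 1) ×ˢ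
      Finset.Icc ⌊(-(2 * ρ)) / r⌋ ⌊(2 * ρ) / r⌋) ?_ ?_).mono subset_rfl ?_
  · rintro t ⟨-, h1, h2, h3, h4⟩
    simp only [Finset.mem_product]
    refine ⟨floor_phase_div_pi_mem hp hn0 h1 h2, floor_phase_div_pi_mem hq hn0 h1 h2, ?_⟩
    have hgt : |g t| ≤ 2 * ρ := by
      refine (abs_add_le _ _).trans ?_
      rw [abs_neg_one_zpow_mul, abs_neg_one_zpow_mul]
      linarith
    rw [abs_le] at hgt
    rw [Finset.mem_Icc]
    constructor <;> apply Int.floor_mono <;> gcongr <;> linarith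
  · have main : ∀ s t : ℝ, 1 < s → s ≤ t → k s = k t → l s = l t → ⌊g s / r⌋ = ⌊g t / r⌋ →
        |(spiralPoint p q s).re - (spiralPoint p q t).re| ≤ r ∧
          |(spiralPoint p q s).im - (spiralPoint p q t).im| ≤ r := by
      intro s t hs hst hkst hlst hgst
      have h1 := rpow_neg_mul_cos_anti hp 0 hs hst hkst
      have h2 := rpow_neg_mul_cos_anti hq (Real.pi / 2) hs hst hlst
      simp only [Real.cos_sub_pi_div_two, sub_zero, ← spiralPoint_im p q, ← spiralPoint_re p q]
        at h1 h2
      have h3 := (abs_le.1 (abs_sub_le_of_floor_div_eq hr hgst)).2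
      simp only [hg, hkst, hlst] at h3
      rw [← abs_neg_one_zpow_mul (k t), ← abs_neg_one_zpow_mul (l t) (_ - _)]
      simp only [hk, hl] at h3 ⊢
      rw [abs_of_nonneg (by linarith), abs_of_nonneg (by linarith)]
      constructor <;> linarith
    rintro s ⟨hs, -⟩ t ⟨ht, -⟩ hst
    simp only [Prod.mk.injEq] at hst
    rcases le_total s t with h | h
    · exact main s t hs h hst.1 hst.2.1 hst.2.2
    · rw [abs_sub_comm, abs_sub_comm (spiralPoint p q s).im]
      exact main t s ht h hst.1.symm hst.2.1.symm hst.2.2.symm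
  · rw [Finset.card_product, Finset.card_product]
    have h2 : ∀ m : ℤ, (Finset.Icc m (m + 1)).card = 2 := by
      intro m
      rw [Int.card_Icc]
      lia
    rw [h2, h2]
    push_cast
    have h3 : -(2 * ρ) / r ≤ 2 * ρ / r := by gcongr; linarith
    have h4 := card_Icc_floor_le h3
    have h5 : 2 * ρ / r - -(2 * ρ) / r = 4 * (ρ / r) := by ring
    linarith

lemma coveredBy_of_arcs {p q : ℝ} (hp : 0 < p) (hq : 0 < q) {r M : ℝ} (hr : 0 < r) (c : ℝ × ℝ)
    {E G : Set ℂ} (hE : E ⊆ spiral p q) (N : ℕ) (ρ : ℕ → ℝ)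
    (hG : ∀ t : ℝ, N + 1 ≤ t → spiralPoint p q t ∈ E → spiralPoint p q t ∈ G)
    (hρ : ∀ n ∈ Finset.Icc 1 N, ∀ t : ℝ, n ≤ t → spiralPoint p q t ∈ E →
      |(spiralPoint p q t).re - c.1| ≤ ρ n ∧ |(spiralPoint p q t).im - c.2| ≤ ρ n)
    (hrρ : ∀ n ∈ Finset.Icc 1 N, r ≤ ρ n) (hM : CoveredBy G r M) :
    CoveredBy E r (24 * ((∑ n ∈ Finset.Icc 1 N, ρ n) / r) + M) := by
  refine ((CoveredBy.biUnion (Finset.Icc 1 N) (M := fun n => 24 * (ρ n / r)) fun n hn =>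
    (coveredBy_arc hp hq (n := n) (ρ := ρ n) (by exact_mod_cast (Finset.mem_Icc.1 hn).1) hr
      (hr.le.trans (hrρ n hn)) c).mono subset_rfl ?_).union hM).mono ?_ ?_
  · have := (one_le_div hr).2 (hrρ n hn)
    linarith
  · intro z hz
    obtain ⟨t, ht, rfl⟩ := mem_spiral_iff.1 (hE hz)
    rcases le_or_gt ((N : ℝ) + 1) t with h | h
    · exact Or.inr (hG t h hz)
    · left
      have ht0 : 0 ≤ t := by linarith
      have hn : ⌊t⌋₊ ∈ Finset.Icc 1 N := by
        rw [Finset.mem_Icc]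
        constructor
        · exact Nat.le_floor (by exact_mod_cast ht.le)
        · exact Nat.lt_succ_iff.1 ((Nat.floor_lt ht0).2 (by exact_mod_cast h))
      refine Set.mem_iUnion₂.2 ⟨⌊t⌋₊, hn, t,
        ⟨ht, Nat.floor_le ht0, (Nat.lt_floor_add_one t).le, ?_⟩, rfl⟩
      exact hρ _ hn t (Nat.floor_le ht0) hz
  · rw [← Finset.mul_sum, ← Finset.sum_div]

lemma sum_rpow_neg_le {p : ℝ} (hp : 0 < p) (hp1 : p < 1) (N : ℕ) :
    ∑ n ∈ Finset.Icc 1 N, (n : ℝ) ^ (-p) ≤ (N : ℝ) ^ (1 - p) / (1 - p) := by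
  have h1p : 0 < 1 - p := by linarith
  induction N with
  | zero => simp [Real.zero_rpow h1p.ne']
  | succ N ih =>
    rw [Finset.sum_Icc_succ_top (by lia)]
    set x : ℝ := ((N + 1 : ℕ) : ℝ) with hx
    have hN : (N : ℝ) = x * (1 + -x⁻¹) := by
      rw [hx]
      push_cast
      field_simp
      ring
    have hx1 : 1 ≤ x := by rw [hx]; push_cast; linarith [Nat.cast_nonneg (α := ℝ) N]
    have hx0 : 0 < x := by linarith
    have hinv : x⁻¹ ≤ 1 := inv_le_one_of_one_le₀ hx1
    have hb := rpow_one_add_le_one_add_mul_self (s := -x⁻¹) (by linarith) h1p.le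
      (by linarith)
    have h2 : (N : ℝ) ^ (1 - p) ≤ x ^ (1 - p) - (1 - p) * x ^ (-p) := by
      rw [hN, Real.mul_rpow hx0.le (by linarith)]
      have h3 : x ^ (-p) = x ^ (1 - p) * x⁻¹ := by
        rw [← Real.rpow_neg_one x, ← Real.rpow_add hx0]
        ring_nf
      rw [h3]
      have := mul_le_mul_of_nonneg_left hb (Real.rpow_nonneg hx0.le (1 - p))
      linarith
    have h4 : (N : ℝ) ^ (1 - p) / (1 - p) ≤ x ^ (1 - p) / (1 - p) - x ^ (-p) := by
      rw [div_le_iff₀ h1p, sub_mul, div_mul_cancel₀ _ h1p.ne']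
      linarith
    linarith

/-- Upper bound for the number of `r`-squares needed for the part of the spiral in a ball of
radius `r ^ θ`. -/
lemma exists_coveredBy_spiral_inter_ball {p q θ : ℝ} (hp : 0 < p) (hpq : p ≤ q) (hp1 : p < 1)
    (hθ1 : θ < 1) : ∃ C : ℝ, 0 < C ∧ ∀ r : ℝ, 0 < r → r < 1 → ∀ x : ℂ,
      CoveredBy (Metric.ball x (r ^ θ) ∩ spiral p q) r
        (C * r ^ (max θ (p / (1 + q)) + max θ (q / (1 + q)) - 2)) := by
  have hq : 0 < q := hp.trans_le hpq
  have h1q : 0 < 1 + q := by linarith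
  have h1p : 0 < 1 - p := by linarith
  refine ⟨24 / (1 - p) + 40, by positivity, fun r hr hr1 x => ?_⟩
  have hrle : ∀ {e : ℝ}, e ≤ 1 → r ≤ r ^ e := fun {e} he => by
    simpa using Real.rpow_le_rpow_of_exponent_ge hr hr1.le he
  have hball : ∀ z ∈ Metric.ball x (r ^ θ), |z.re - x.re| ≤ r ^ θ ∧ |z.im - x.im| ≤ r ^ θ := by
    intro z hz
    rw [Metric.mem_ball, dist_eq_norm] at hz
    have h1 := Complex.abs_re_le_norm (z - x)
    have h2 := Complex.abs_im_le_norm (z - x)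
    rw [Complex.sub_re] at h1
    rw [Complex.sub_im] at h2
    exact ⟨h1.trans hz.le, h2.trans hz.le⟩
  have hpq' : p / (1 + q) ≤ q / (1 + q) := by gcongr
  have hq1 : q / (1 + q) ≤ 1 := (div_le_one h1q).2 (by linarith)
  have hdiv : ∀ a b : ℝ, r ^ a * r ^ b / r ^ 2 = r ^ (a + b - 2) := by
    intro a b
    rw [Real.rpow_sub hr, Real.rpow_add hr, Real.rpow_two]
  rcases le_or_gt (q / (1 + q)) θ with hθq | hθq
  · rw [max_eq_left hθq, max_eq_left (hpq'.trans hθq)]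
    refine (coveredBy_box (c := (x.re, x.im)) hr (hrle hθ1.le) (hrle hθ1.le)).mono
      (fun z hz => hball z hz.1) ?_
    rw [hdiv]
    gcongr
    have : 0 < 24 / (1 - p) := by positivity
    linarith
  rw [max_eq_right hθq.le]
  set K : ℝ := r ^ (-(1 / (1 + q))) with hK
  have hK0 : 0 < K := Real.rpow_pos_of_pos hr _
  have hKp : ∀ e, K ^ (-e) = r ^ (e / (1 + q)) := by
    intro e
    rw [hK, ← Real.rpow_mul hr.le]
    congr 1
    ring
  have hNK : ((⌊K⌋₊ : ℕ) : ℝ) ≤ K := Nat.floor_le hK0.le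
  have htK : ∀ t : ℝ, (⌊K⌋₊ : ℝ) + 1 ≤ t → K ≤ t := fun t ht =>
    (Nat.lt_floor_add_one K).le.trans ht
  have hKr : ∀ a, r ^ a * K / r = r ^ (a + q / (1 + q) - 2) := by
    intro a
    rw [hK, ← Real.rpow_add hr, ← Real.rpow_sub_one hr.ne']
    congr 1
    field_simp
    ring
  rcases le_or_gt (p / (1 + q)) θ with hθp | hθp
  · rw [max_eq_left hθp]
    refine (coveredBy_of_arcs hp hq hr (x.re, x.im) Set.inter_subset_right ⌊K⌋₊ (fun _ => r ^ θ)
      ?_ (fun n hn t _ ht => hball _ ht.1) (fun n hn => hrle hθ1.le)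
      (coveredBy_box (c := (x.re, 0)) hr (hrle hθ1.le) (hrle hq1))).mono subset_rfl ?_
    · intro t ht hz
      refine ⟨(hball _ hz.1).1, ?_⟩
      rw [sub_zero, ← hKp]
      exact abs_spiralPoint_im_le p hq hK0 (htK t ht)
    · rw [hdiv, Finset.sum_const, Nat.card_Icc, nsmul_eq_mul, Nat.add_sub_cancel]
      have h1 : (⌊K⌋₊ : ℝ) * r ^ θ / r ≤ r ^ (θ + q / (1 + q) - 2) := by
        rw [← hKr, mul_comm]
        gcongr
      have h2 : 0 ≤ 24 / (1 - p) * r ^ (θ + q / (1 + q) - 2) := by positivity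
      linarith
  · rw [max_eq_right hθp.le]
    refine (coveredBy_of_arcs hp hq hr 0 Set.inter_subset_right ⌊K⌋₊ (fun n => (n : ℝ) ^ (-p))
      ?_ ?_ ?_ (coveredBy_box (c := 0) hr (hrle (hpq'.trans hq1)) (hrle hq1))).mono subset_rfl ?_
    · intro t ht hz
      simp only [Set.mem_ofPred_eq, Prod.fst_zero, Prod.snd_zero, sub_zero]
      rw [← hKp, ← hKp]
      exact ⟨abs_spiralPoint_re_le q hp hK0 (htK t ht), abs_spiralPoint_im_le p hq hK0 (htK t ht)⟩
    · intro n hn t hnt _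
      have hn1 : (1 : ℝ) ≤ n := by exact_mod_cast (Finset.mem_Icc.1 hn).1
      simp only [Prod.fst_zero, Prod.snd_zero, sub_zero]
      refine ⟨abs_spiralPoint_re_le q hp (by linarith) hnt,
        (abs_spiralPoint_im_le p hq (by linarith) hnt).trans ?_⟩
      exact Real.rpow_le_rpow_of_exponent_le hn1 (by linarith)
    · intro n hn
      have hn1 : (1 : ℝ) ≤ n := by exact_mod_cast (Finset.mem_Icc.1 hn).1
      have hnK : (n : ℝ) ≤ K := le_trans (by exact_mod_cast (Finset.mem_Icc.1 hn).2) hNK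
      refine (hrle (hpq'.trans hq1)).trans ?_
      rw [← hKp]
      exact Real.rpow_le_rpow_of_nonpos (by linarith) hnK (by linarith)
    · rw [hdiv]
      have h1 : (∑ n ∈ Finset.Icc 1 ⌊K⌋₊, (n : ℝ) ^ (-p)) / r ≤
          r ^ (p / (1 + q) + q / (1 + q) - 2) / (1 - p) := by
        rw [← hKr, ← hKp, ← Real.rpow_add_one hK0.ne', div_right_comm]
        gcongr
        refine (sum_rpow_neg_le hp hp1 _).trans ?_
        rw [neg_add_eq_sub]
        gcongr
      have h2 : 0 ≤ r ^ (p / (1 + q) + q / (1 + q) - 2) := by positivity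
      have h3 : 24 / (1 - p) * r ^ (p / (1 + q) + q / (1 + q) - 2) =
        24 * (r ^ (p / (1 + q) + q / (1 + q) - 2) / (1 - p)) := by ring
      linarith

lemma abs_rpow_neg_sub_rpow_neg_le {β m s t : ℝ} (hβ : 0 ≤ β) (hm : 0 < m) (hs : m ≤ s)
    (ht : m ≤ t) : |t ^ (-β) - s ^ (-β)| ≤ β * m ^ (-(β + 1)) * |t - s| := by
  refine Convex.norm_image_sub_le_of_norm_hasDerivWithin_le (s := Set.Ici m)
    (f := fun t : ℝ => t ^ (-β)) (f' := fun t => -β * t ^ (-β - 1)) ?_ ?_ (convex_Ici m) hs ht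
  · intro x hx
    exact (Real.hasDerivAt_rpow_const (Or.inl (hm.trans_le hx).ne')).hasDerivWithinAt
  · intro x hx
    have hx0 : 0 < x := hm.trans_le hx
    rw [Real.norm_eq_abs, abs_mul, abs_neg, abs_of_nonneg hβ, abs_of_nonneg (by positivity)]
    gcongr ?_ * ?_
    rw [show -β - 1 = -(β + 1) by ring]
    exact Real.rpow_le_rpow_of_nonpos hm hx (by linarith)

/-- The squared height of the spiral above abscissa `u` varies slowly with the parameter. -/
lemma abs_sq_height_sub_le {p q u T m s t : ℝ} (hp : 0 < p) (hpq : p ≤ q) (hm : 0 < m)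
    (hmT : m ≤ T) (hu0 : 0 ≤ u) (hu : u ≤ T ^ (-p)) (hs : m ≤ s) (ht : m ≤ t) :
    |(t ^ (-(2 * q)) - u ^ 2 * t ^ (-(2 * (q - p)))) -
      (s ^ (-(2 * q)) - u ^ 2 * s ^ (-(2 * (q - p))))| ≤
      4 * q * m ^ (-(2 * q + 1)) * |t - s| := by
  have h1 := abs_rpow_neg_sub_rpow_neg_le (β := 2 * q) (by linarith) hm hs ht
  have h2 := abs_rpow_neg_sub_rpow_neg_le (β := 2 * (q - p)) (by linarith) hm hs ht
  have hu2 : u ^ 2 ≤ m ^ (-(2 * p)) := by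
    have h3 : u ≤ m ^ (-p) := hu.trans (Real.rpow_le_rpow_of_nonpos hm hmT (by linarith))
    calc u ^ 2 ≤ (m ^ (-p)) ^ 2 := by gcongr
      _ = m ^ (-(2 * p)) := by
        rw [← Real.rpow_natCast, ← Real.rpow_mul hm.le]
        congr 1
        push_cast
        ring
  have h4 : m ^ (-(2 * p)) * m ^ (-(2 * (q - p) + 1)) = m ^ (-(2 * q + 1)) := by
    rw [← Real.rpow_add hm]
    congr 1
    ring
  calc _ = |(t ^ (-(2 * q)) - s ^ (-(2 * q))) -
        u ^ 2 * (t ^ (-(2 * (q - p))) - s ^ (-(2 * (q - p))))| := by congr 1; ring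
    _ ≤ |t ^ (-(2 * q)) - s ^ (-(2 * q))| +
        |u ^ 2 * (t ^ (-(2 * (q - p))) - s ^ (-(2 * (q - p))))| := abs_sub _ _
    _ ≤ 2 * q * m ^ (-(2 * q + 1)) * |t - s| +
        m ^ (-(2 * p)) * (2 * (q - p) * m ^ (-(2 * (q - p) + 1)) * |t - s|) := by
      rw [abs_mul, abs_of_nonneg (sq_nonneg u)]
      gcongr
    _ = (2 * q + 2 * (q - p)) * m ^ (-(2 * q + 1)) * |t - s| := by
      rw [← h4]
      ring
    _ ≤ _ := by
      gcongr
      linarith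

lemma exists_sq_height_eq {p q T u v : ℝ} (hp : 0 < p) (hpq : p ≤ q) (hT : 0 < T)
    (hu : u ∈ Set.Icc 0 (T ^ (-p) / 4)) (hv : v ∈ Set.Icc (T ^ (-q) / 2) (3 / 4 * T ^ (-q))) :
    ∃ s, T ≤ s ∧ u ≤ s ^ (-p) ∧ s ^ (-(2 * q)) - u ^ 2 * s ^ (-(2 * (q - p))) = v ^ 2 := by
  have hq : 0 < q := hp.trans_le hpq
  have hsq : ∀ x e : ℝ, 0 < x → x ^ (-(2 * e)) = (x ^ (-e)) ^ 2 := by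
    intro x e hx
    rw [← Real.rpow_natCast, ← Real.rpow_mul hx.le]
    congr 1
    push_cast
    ring
  set L : ℝ := 2 ^ (1 / q) with hL
  have hL1 : 1 ≤ L := Real.one_le_rpow one_le_two (by positivity)
  have hL0 : 0 < L := by linarith
  have hLq : L ^ (-q) = 1 / 2 := by
    rw [hL, ← Real.rpow_mul zero_le_two, mul_neg, one_div_mul_cancel hq.ne', Real.rpow_neg_one]
    norm_num
  have hTL : T ≤ L * T := le_mul_of_one_le_left hT.le hL1
  have hcont : ContinuousOn (fun t : ℝ => t ^ (-(2 * q)) - u ^ 2 * t ^ (-(2 * (q - p))))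
      (Set.Icc T (L * T)) := by
    have h : ∀ e : ℝ, ContinuousOn (fun t : ℝ => t ^ e) (Set.Icc T (L * T)) := fun e =>
      continuousOn_id.rpow_const fun t ht => Or.inl (hT.trans_le ht.1).ne'
    exact (h _).sub ((h _).const_smul (u ^ 2))
  have hv0 : 0 < T ^ (-q) := by positivity
  have hmem : v ^ 2 ∈ Set.Icc ((L * T) ^ (-(2 * q)) - u ^ 2 * (L * T) ^ (-(2 * (q - p))))
      (T ^ (-(2 * q)) - u ^ 2 * T ^ (-(2 * (q - p)))) := by
    constructor
    · have h1 : (L * T) ^ (-(2 * q)) = (T ^ (-q) / 2) ^ 2 := by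
        rw [hsq _ _ (by positivity), Real.mul_rpow hL0.le hT.le, hLq]
        ring
      have h2 : 0 ≤ u ^ 2 * (L * T) ^ (-(2 * (q - p))) := by positivity
      have h3 : (T ^ (-q) / 2) ^ 2 ≤ v ^ 2 := by
        have := hv.1
        gcongr
      linarith
    · have h1 : T ^ (-(2 * q)) = (T ^ (-q)) ^ 2 := hsq _ _ hT
      have h2 : u ^ 2 * T ^ (-(2 * (q - p))) ≤ (T ^ (-q)) ^ 2 / 16 := by
        have h4 : T ^ (-q) = T ^ (-p) * T ^ (-(q - p)) := by
          rw [← Real.rpow_add hT]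
          congr 1
          ring
        have h5 := hu.1
        have h6 := hu.2
        calc u ^ 2 * T ^ (-(2 * (q - p))) ≤ (T ^ (-p) / 4) ^ 2 * T ^ (-(2 * (q - p))) := by
              gcongr
          _ = _ := by
              rw [hsq _ _ hT, h4]
              ring
      have h3 : v ^ 2 ≤ (3 / 4 * T ^ (-q)) ^ 2 := by
        have := hv.2
        have : 0 ≤ v := le_trans (by positivity) hv.1
        gcongr
      nlinarith
  obtain ⟨s, hs, hsv⟩ := intermediate_value_Icc' hTL hcont hmem
  refine ⟨s, hs.1, ?_, hsv⟩
  have hLp : 1 / 2 ≤ L ^ (-p) := by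
    rw [← hLq]
    exact Real.rpow_le_rpow_of_exponent_le hL1 (by linarith)
  calc u ≤ T ^ (-p) / 4 := hu.2
    _ ≤ L ^ (-p) * T ^ (-p) := by
      have : 0 < T ^ (-p) := by positivity
      nlinarith
    _ = (L * T) ^ (-p) := (Real.mul_rpow hL0.le hT.le).symm
    _ ≤ s ^ (-p) := Real.rpow_le_rpow_of_nonpos (hT.trans_le hs.1) hs.2 (by linarith)

/-- At scale `T`, the spiral is `O(T ^ (-(q + 1)))`-dense along vertical segments of a box with
sides comparable to `T ^ (-p)` and `T ^ (-q)`. -/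
lemma exists_spiralPoint_near {p q : ℝ} (hp : 0 < p) (hpq : p ≤ q) :
    ∃ A : ℝ, 0 < A ∧ ∀ T : ℝ, 4 * Real.pi ≤ T → ∀ u ∈ Set.Icc 0 (T ^ (-p) / 4),
      ∀ v ∈ Set.Icc (T ^ (-q) / 2) (3 / 4 * T ^ (-q)),
        ∃ z ∈ spiral p q, z.re = u ∧ |z.im - v| ≤ A * T ^ (-(q + 1)) := by
  have hq : 0 < q := hp.trans_le hpq
  have hpi := Real.pi_gt_three
  refine ⟨16 * Real.pi * q * 2 ^ (2 * q + 1), by positivity, fun T hT u hu v hv => ?_⟩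
  have hT0 : 0 < T := by linarith
  obtain ⟨s, hTs, hus, hsv⟩ := exists_sq_height_eq hp hpq hT0 hu hv
  set a : ℝ := (⌊s / (2 * Real.pi)⌋₊ : ℝ) * (2 * Real.pi) with ha
  have has : a ≤ s := by
    rw [ha, ← le_div_iff₀ (by positivity)]
    exact Nat.floor_le (div_nonneg (by linarith) (by positivity))
  have hsa : s ≤ a + 2 * Real.pi := by
    have := (Nat.lt_floor_add_one (s / (2 * Real.pi))).le
    rw [div_le_iff₀ (by positivity)] at this
    linarith
  have hTa : T / 2 ≤ a := by linarith
  have ha1 : 1 < a := by linarith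
  have hcos : Real.cos a = 1 := Real.cos_nat_mul_two_pi _
  have hcos' : Real.cos (a + Real.pi / 2) = 0 := by
    have hsin : Real.sin a = 0 := by simpa [hcos] using Real.sin_sq_add_cos_sq a
    rw [Real.cos_add_pi_div_two, hsin, neg_zero]
  obtain ⟨t, ht, htu⟩ := intermediate_value_Icc' (f := fun t : ℝ => t ^ (-p) * Real.cos t)
    (show a ≤ a + Real.pi / 2 by linarith)
    ((continuousOn_id.rpow_const fun t ht => Or.inl (by
      have := ht.1
      simp only [id]
      linarith)).mul Real.continuous_cos.continuousOn)
    (show u ∈ _ from ⟨by simpa [hcos'] using hu.1, by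
      simp only [hcos, mul_one]
      exact hus.trans (Real.rpow_le_rpow_of_nonpos (by linarith) has (by linarith))⟩)
  have ht0 : 0 < t := by linarith [ht.1]
  refine ⟨spiralPoint p q t, mem_spiral_iff.2 ⟨t, by linarith [ht.1], rfl⟩, ?_, ?_⟩
  · rw [spiralPoint_re]
    exact htu
  have hsin : 0 ≤ Real.sin t := by
    have h : Real.sin t = Real.sin (t - a) := by rw [ha, Real.sin_sub_nat_mul_two_pi]
    rw [h]
    apply Real.sin_nonneg_of_nonneg_of_le_pi <;> linarith [ht.1, ht.2]
  set y := (spiralPoint p q t).im with hy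
  have hy0 : 0 ≤ y := by
    rw [hy, spiralPoint_im]
    positivity
  have hysq : y ^ 2 = t ^ (-(2 * q)) - u ^ 2 * t ^ (-(2 * (q - p))) := by
    have h1 : t ^ (-(2 * q)) = (t ^ (-q)) ^ 2 := by
      rw [← Real.rpow_natCast, ← Real.rpow_mul ht0.le]
      congr 1
      push_cast
      ring
    have h2 : (t ^ (-p)) ^ 2 * t ^ (-(2 * (q - p))) = t ^ (-(2 * q)) := by
      rw [← Real.rpow_natCast, ← Real.rpow_mul ht0.le, ← Real.rpow_add ht0]
      congr 1
      push_cast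
      ring
    have h3 := Real.sin_sq_add_cos_sq t
    simp only at htu
    rw [hy, spiralPoint_im, ← htu, mul_pow, mul_pow, Real.sin_sq, mul_right_comm, h2, h1]
    ring
  have hts : |t - s| ≤ 2 * Real.pi := by
    rw [abs_le]
    constructor <;> linarith [ht.1, ht.2]
  have hq4 : 0 < T ^ (-p) := by positivity
  have hdiff := abs_sq_height_sub_le (T := T) hp hpq (half_pos hT0) (by linarith) hu.1
    (hu.2.trans (by linarith)) (by linarith : T / 2 ≤ s) (hTa.trans ht.1)
  rw [← hysq, hsv] at hdiff
  have hTq : 0 < T ^ (-q) := by positivity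
  have hv0 : 0 ≤ v := le_trans (by positivity) hv.1
  have hfac : |y ^ 2 - v ^ 2| = |y - v| * (y + v) := by
    rw [sq_sub_sq, abs_mul, abs_of_nonneg (add_nonneg hy0 hv0), mul_comm]
  have hm : (T / 2) ^ (-(2 * q + 1)) = 2 ^ (2 * q + 1) * (T ^ (-(q + 1)) * T ^ (-q)) := by
    rw [Real.div_rpow hT0.le zero_le_two, ← Real.rpow_add hT0, Real.rpow_neg zero_le_two,
      div_inv_eq_mul, mul_comm]
    congr 2
    ring
  have hlow : |y - v| * (T ^ (-q) / 2) ≤ |y ^ 2 - v ^ 2| := by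
    rw [hfac]
    gcongr
    linarith [hv.1]
  have hup : |y ^ 2 - v ^ 2| ≤
      (16 * Real.pi * q * 2 ^ (2 * q + 1) * T ^ (-(q + 1))) * (T ^ (-q) / 2) := by
    refine hdiff.trans ?_
    calc _ ≤ 4 * q * (T / 2) ^ (-(2 * q + 1)) * (2 * Real.pi) := by gcongr
      _ = _ := by
        rw [hm]
        ring
  exact le_of_mul_le_mul_right (hlow.trans hup) (by positivity)

lemma volume_re_im_Icc (a b c d : ℝ) :
    volume {z : ℂ | z.re ∈ Set.Icc a b ∧ z.im ∈ Set.Icc c d} =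
      ENNReal.ofReal (b - a) * ENNReal.ofReal (d - c) := by
  have h : {z : ℂ | z.re ∈ Set.Icc a b ∧ z.im ∈ Set.Icc c d} =
      Complex.measurableEquivRealProd ⁻¹' (Set.Icc a b ×ˢ Set.Icc c d) := by
    ext z
    simp only [Set.mem_preimage, Complex.measurableEquivRealProd_apply, Set.mem_prod]
    rfl
  rw [h, Complex.volume_preserving_equiv_real_prod.measure_preimage
    (measurableSet_Icc.prod measurableSet_Icc).nullMeasurableSet, Measure.volume_eq_prod,
    Measure.prod_prod, Real.volume_Icc, Real.volume_Icc]

/-- If every point of a box is `A * r`-close to `E` along vertical lines, then a cover of `E` by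
squares has at least the expected cardinality. -/
lemma area_le_of_subset_iUnion_closedSquare {E : Set ℂ} {a b c d r A : ℝ} {n : ℕ} (hr : 0 < r)
    (hA : 0 ≤ A) (hab : a ≤ b) (s : Fin n → ℝ × ℝ)
    (hs : E ⊆ ⋃ i, closedSquare (s i) r)
    (hE : ∀ u ∈ Set.Icc a b, ∀ v ∈ Set.Icc c d, ∃ z ∈ E, z.re = u ∧ |z.im - v| ≤ A * r) :
    (b - a) * (d - c) ≤ n * ((1 + 2 * A) * r) ^ 2 := by
  have hsub : {z : ℂ | z.re ∈ Set.Icc a b ∧ z.im ∈ Set.Icc c d} ⊆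
      ⋃ i, closedSquare ((s i).1 - A * r, (s i).2 - A * r) ((1 + 2 * A) * r) := by
    rintro w ⟨hw1, hw2⟩
    obtain ⟨z, hz, hzre, hzim⟩ := hE _ hw1 _ hw2
    obtain ⟨i, hi⟩ := Set.mem_iUnion.1 (hs hz)
    obtain ⟨⟨h1, h2⟩, h3, h4⟩ := hi
    rw [abs_le] at hzim
    have hAr : 0 ≤ A * r := by positivity
    refine Set.mem_iUnion.2 ⟨i, ⟨?_, ?_⟩, ?_, ?_⟩ <;> simp only <;> linarith
  have hvol := (measure_mono (μ := volume) hsub).trans (measure_iUnion_fintype_le _ _)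
  have hsq : ∀ i, volume (closedSquare ((s i).1 - A * r, (s i).2 - A * r) ((1 + 2 * A) * r)) =
      ENNReal.ofReal (((1 + 2 * A) * r) ^ 2) := by
    intro i
    rw [closedSquare, volume_re_im_Icc, add_sub_cancel_left, add_sub_cancel_left,
      ← ENNReal.ofReal_mul (by positivity), sq]
  rw [volume_re_im_Icc, ← ENNReal.ofReal_mul (by linarith)] at hvol
  simp only [hsq, Finset.sum_const, Finset.card_univ, Fintype.card_fin, nsmul_eq_mul] at hvol
  rw [← ENNReal.ofReal_natCast, ← ENNReal.ofReal_mul (by positivity)] at hvol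
  exact (ENNReal.ofReal_le_ofReal_iff (by positivity)).1 hvol

lemma exists_mem_spiral_norm_lt {p q ε : ℝ} (hp : 0 < p) (hpq : p ≤ q) (hε : 0 < ε) :
    ∃ x ∈ spiral p q, ‖x‖ < ε := by
  obtain ⟨t, ht, ht1⟩ := (((tendsto_rpow_neg_atTop hp).eventually_lt_const
    (half_pos hε)).and (Filter.eventually_gt_atTop 1)).exists
  refine ⟨spiralPoint p q t, mem_spiral_iff.2 ⟨t, ht1, rfl⟩, ?_⟩
  have h1 := Complex.norm_le_abs_re_add_abs_im (spiralPoint p q t)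
  have h2 := abs_spiralPoint_re_le q hp (zero_lt_one.trans ht1) le_rfl
  have h3 := abs_spiralPoint_im_le p (hp.trans_le hpq) (zero_lt_one.trans ht1) le_rfl
  have h4 : t ^ (-q) ≤ t ^ (-p) := Real.rpow_le_rpow_of_exponent_le ht1.le (by linarith)
  linarith

/-- Lower bound for the number of `r`-squares needed for the part of the spiral in a suitable
ball of radius `r ^ θ`. -/
lemma exists_le_sqCoverNum_spiral {p q θ : ℝ} (hp : 0 < p) (hpq : p ≤ q) (hp1 : p < 1)
    (hθ0 : 0 ≤ θ) (hθ1 : θ < 1) : ∃ C : ℝ, 0 < C ∧ ∀ r : ℝ, 0 < r → r < 1 → ∃ x ∈ spiral p q,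
      C * r ^ (max θ (p / (1 + q)) + max θ (q / (1 + q)) - 2) ≤
        sqCoverNum (Metric.ball x (r ^ θ) ∩ spiral p q) r := by
  have hq : 0 < q := hp.trans_le hpq
  have h1q : 0 < 1 + q := by linarith
  have hpi := Real.pi_gt_three
  obtain ⟨A, hA, hnear⟩ := exists_spiralPoint_near hp hpq
  obtain ⟨B, hB, hBpi⟩ := (((tendsto_rpow_neg_atTop hq).eventually_lt_const
    (show 0 < 1 / (4 * (1 + A)) by positivity)).and
      (Filter.eventually_ge_atTop (4 * Real.pi))).exists
  have hB1 : 1 ≤ B := by linarith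
  have hB0 : 0 < B := by linarith
  refine ⟨B ^ (-p) * B ^ (-q) / (16 * (1 + 2 * A) ^ 2), by positivity, fun r hr hr1 => ?_⟩
  set R := r ^ θ with hR
  have hR0 : 0 < R := Real.rpow_pos_of_pos hr θ
  set a := max θ (p / (1 + q)) with ha
  set b := max θ (q / (1 + q)) with hb
  have hb0 : 0 ≤ b := hθ0.trans (le_max_left _ _)
  set T := B * r ^ (-(b / q)) with hT
  have hTe : ∀ e, T ^ (-e) = B ^ (-e) * r ^ (b * e / q) := by
    intro e
    rw [hT, Real.mul_rpow hB0.le (by positivity), ← Real.rpow_mul hr.le]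
    congr 2
    ring
  have hBT : B ≤ T := le_mul_of_one_le_right hB0.le
    (Real.one_le_rpow_of_pos_of_le_one_of_nonpos hr hr1.le (neg_nonpos.2 (by positivity)))
  have hT1 : 1 ≤ T := hB1.trans hBT
  have hT0 : 0 < T := by linarith
  have hTq : T ^ (-q) = B ^ (-q) * r ^ b := by rw [hTe, mul_div_cancel_right₀ _ hq.ne']
  have hTqR : (1 + A) * T ^ (-q) ≤ R / 4 := by
    have h1 : r ^ b ≤ R := Real.rpow_le_rpow_of_exponent_ge hr hr1.le (le_max_left _ _)
    rw [hTq]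
    calc (1 + A) * (B ^ (-q) * r ^ b) ≤ (1 + A) * (1 / (4 * (1 + A)) * R) := by gcongr
      _ = R / 4 := by field_simp
  have hTr : T ^ (-(q + 1)) ≤ r := by
    have h1 : B ^ (-(q + 1)) ≤ 1 := Real.rpow_le_one_of_one_le_of_nonpos hB1 (by linarith)
    have h2 : r ^ (b * (q + 1) / q) ≤ r := by
      conv_rhs => rw [← Real.rpow_one r]
      apply Real.rpow_le_rpow_of_exponent_ge hr hr1.le
      have h3 : q / (1 + q) ≤ b := le_max_right _ _
      rw [div_le_iff₀ h1q] at h3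
      rw [le_div_iff₀ hq]
      linarith
    rw [hTe]
    calc _ ≤ 1 * r := by gcongr
      _ = r := one_mul r
  have hTp : B ^ (-p) * r ^ a ≤ min (T ^ (-p)) R := by
    apply le_min
    · rw [hTe]
      gcongr B ^ (-p) * ?_
      apply Real.rpow_le_rpow_of_exponent_ge hr hr1.le
      rw [div_le_iff₀ hq, hb, max_mul_of_nonneg _ _ hp.le]
      apply max_le
      · exact mul_le_mul (le_max_left _ _) hpq hp.le (hθ0.trans (le_max_left _ _))
      · have : p / (1 + q) * q ≤ a * q := by gcongr; exact le_max_right _ _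
        refine le_trans (le_of_eq ?_) this
        ring
    · have h1 : B ^ (-p) ≤ 1 := Real.rpow_le_one_of_one_le_of_nonpos hB1 (by linarith)
      have h2 : r ^ a ≤ R := Real.rpow_le_rpow_of_exponent_ge hr hr1.le (le_max_left _ _)
      calc _ ≤ 1 * R := by gcongr
        _ = R := one_mul R
  obtain ⟨x, hx, hxR⟩ := exists_mem_spiral_norm_lt hp hpq (show 0 < R / 4 by positivity)
  refine ⟨x, hx, ?_⟩
  have hcover : sqCoverNum (Metric.ball x R ∩ spiral p q) r ∈
      {n : ℕ | ∃ c : Fin n → ℝ × ℝ,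
        Metric.ball x R ∩ spiral p q ⊆ ⋃ i, closedSquare (c i) r} := by
    obtain ⟨C, -, hC⟩ := exists_coveredBy_spiral_inter_ball hp hpq hp1 hθ1
    obtain ⟨n, -, hn⟩ := (hC r hr hr1 x).exists_fin
    exact Nat.sInf_mem ⟨n, hn⟩
  obtain ⟨c, hc⟩ := hcover
  have hTq0 : 0 < T ^ (-q) := by positivity
  have hmin0 : 0 ≤ min (T ^ (-p)) R := le_trans (by positivity) hTp
  have harea := area_le_of_subset_iUnion_closedSquare (a := 0) (b := min (T ^ (-p)) R / 4)
    (c := T ^ (-q) / 2) (d := 3 / 4 * T ^ (-q)) hr hA.le (by linarith) c hc (by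
      intro u hu v hv
      have h1 := min_le_left (T ^ (-p)) R
      have h2 := min_le_right (T ^ (-p)) R
      obtain ⟨z, hz, hzu, hzv⟩ := hnear T (hBpi.trans hBT) u ⟨hu.1, by linarith [hu.2]⟩ v hv
      refine ⟨z, ⟨?_, hz⟩, hzu, hzv.trans (by gcongr)⟩
      have h3 : T ^ (-(q + 1)) ≤ T ^ (-q) := Real.rpow_le_rpow_of_exponent_le hT1 (by linarith)
      have h4 : A * T ^ (-(q + 1)) ≤ A * T ^ (-q) := by gcongr
      have h5 : |z.im| ≤ (1 + A) * T ^ (-q) := by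
        rw [abs_le] at hzv ⊢
        constructor <;> linarith [hv.1, hv.2]
      have h6 : |z.re| ≤ R / 4 := by
        rw [hzu, abs_of_nonneg hu.1]
        linarith [hu.2]
      rw [Metric.mem_ball, dist_eq_norm]
      linarith [norm_sub_le z x, Complex.norm_le_abs_re_add_abs_im z])
  have hfin : B ^ (-p) * B ^ (-q) / 16 * (r ^ a * r ^ b) ≤
      sqCoverNum (Metric.ball x R ∩ spiral p q) r * ((1 + 2 * A) * r) ^ 2 := by
    refine le_trans ?_ harea
    calc _ = (B ^ (-p) * r ^ a) * (B ^ (-q) * r ^ b) / 16 := by ring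
      _ ≤ min (T ^ (-p)) R * T ^ (-q) / 16 := by
        rw [hTq]
        gcongr
      _ = _ := by ring
  rw [Real.rpow_sub hr, Real.rpow_add hr, Real.rpow_two]
  calc _ = B ^ (-p) * B ^ (-q) / 16 * (r ^ a * r ^ b) / ((1 + 2 * A) * r) ^ 2 := by
        field_simp
    _ ≤ _ := by
        rw [div_le_iff₀ (by positivity)]
        exact hfin

lemma le_of_forall_rpow_le_mul_rpow {a b C : ℝ}
    (h : ∀ r : ℝ, 0 < r → r < 1 → r ^ a ≤ C * r ^ b) : b ≤ a := by
  by_contra! hab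
  have ht := tendsto_rpow_neg_nhdsGT_zero (sub_neg.2 hab)
  obtain ⟨r, hrC, hr0, hr1⟩ := ((ht.eventually_gt_atTop C).and
    (Ioo_mem_nhdsGT (zero_lt_one' ℝ))).exists
  have h1 := h r hr0 hr1
  rw [Real.rpow_sub hr0, lt_div_iff₀ (Real.rpow_pos_of_pos hr0 b)] at hrC
  linarith

lemma assouadSpectrum_spiral_eq {p q θ : ℝ} (hp : 0 < p) (hpq : p ≤ q) (hp1 : p < 1)
    (hθ0 : 0 ≤ θ) (hθ1 : θ < 1) :
    assouadSpectrum θ (spiral p q) =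
      (2 - max θ (p / (1 + q)) - max θ (q / (1 + q))) / (1 - θ) := by
  have h1θ : 0 < 1 - θ := by linarith
  have h1q : 0 < 1 + q := by linarith
  have hpow : ∀ r α : ℝ, 0 < r → (r ^ θ / r) ^ α = r ^ (-((1 - θ) * α)) := by
    intro r α hr
    rw [← Real.rpow_sub_one hr.ne', ← Real.rpow_mul hr.le]
    congr 1
    ring
  have hexp : -((1 - θ) * ((2 - max θ (p / (1 + q)) - max θ (q / (1 + q))) / (1 - θ))) =
      max θ (p / (1 + q)) + max θ (q / (1 + q)) - 2 := by
    field_simp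
    ring
  have hleast : IsLeast {α : ℝ | 0 ≤ α ∧ ∃ C : ℝ, 0 < C ∧ ∀ r : ℝ, 0 < r → r < 1 →
      ∀ x ∈ spiral p q,
        (sqCoverNum (Metric.ball x (r ^ θ) ∩ spiral p q) r : ℝ) ≤ C * (r ^ θ / r) ^ α}
      ((2 - max θ (p / (1 + q)) - max θ (q / (1 + q))) / (1 - θ)) := by
    constructor
    · refine ⟨div_nonneg ?_ h1θ.le, ?_⟩
      · have h1 : max θ (p / (1 + q)) ≤ 1 :=
          max_le hθ1.le ((div_le_one h1q).2 (by linarith))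
        have h2 : max θ (q / (1 + q)) ≤ 1 :=
          max_le hθ1.le ((div_le_one h1q).2 (by linarith))
        linarith
      · obtain ⟨C, hC, h⟩ := exists_coveredBy_spiral_inter_ball hp hpq hp1 hθ1
        refine ⟨C, hC, fun r hr hr1 x _ => ?_⟩
        rw [hpow r _ hr, hexp]
        exact (h r hr hr1 x).sqCoverNum_le
    · rintro α ⟨-, C, hC, hα⟩
      obtain ⟨c, hc, h⟩ := exists_le_sqCoverNum_spiral hp hpq hp1 hθ0 hθ1
      have key := le_of_forall_rpow_le_mul_rpow (C := C / c) fun r hr hr1 => by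
        obtain ⟨x, hx, hle⟩ := h r hr hr1
        have h1 := hle.trans (hα r hr hr1 x hx)
        rw [hpow r _ hr, mul_comm c, ← le_div_iff₀ hc, mul_div_right_comm] at h1
        exact h1
      rw [div_le_iff₀ h1θ]
      linarith
  exact hleast.csInf_eq

theorem assouadSpectrum_spiral_of_lt_one (p q θ : ℝ) (hp : 0 < p) (hpq : p ≤ q)
    (hp1 : p < 1) (hθ0 : 0 ≤ θ) (hθ1 : θ < 1) :
    assouadSpectrum θ (spiral p q) =
      if θ < p / (1 + q) then (2 + q - p) / ((1 + q) * (1 - θ))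
      else if θ < q / (1 + q) then (2 + q - θ * (1 + q)) / ((1 + q) * (1 - θ))
      else 2 := by
  have h1q : 0 < 1 + q := by linarith
  have h1θ : 1 - θ ≠ 0 := by linarith
  have hpq' : p / (1 + q) ≤ q / (1 + q) := by gcongr
  rw [assouadSpectrum_spiral_eq hp hpq hp1 hθ0 hθ1]
  split_ifs with h1 h2
  · rw [max_eq_right h1.le, max_eq_right (h1.le.trans hpq')]
    field_simp
    ring
  · rw [max_eq_left (not_lt.1 h1), max_eq_right h2.le]
    field_simp
    ring
  · rw [max_eq_left (not_lt.1 h1), max_eq_left (not_lt.1 h2)]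
    field_simp
    ring
end

section
/- For all 0 < p ≤ q, the Assouad dimension of S_{p,q} equals 2. -/
open Set Metric MeasureTheory

/-- The Assouad dimension of `F ⊆ ℂ`. -/
noncomputable def assouadDim (F : Set ℂ) : ℝ :=
  sInf {α : ℝ | 0 ≤ α ∧ ∃ C : ℝ, 0 < C ∧ ∀ r R : ℝ, 0 < r → r < R → ∀ x ∈ F,
    (sqCoverNum (Metric.ball x R ∩ F) r : ℝ) ≤ C * (R / r) ^ α}

theorem exists_cover_ball (x : ℂ) {r R : ℝ} (hr : 0 < r) (F : Set ℂ) :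
    ∃ c : Fin (⌈2 * R / r⌉₊ * ⌈2 * R / r⌉₊) → ℝ × ℝ,
      Metric.ball x R ∩ F ⊆ ⋃ i, closedSquare (c i) r := by
  set n := ⌈2 * R / r⌉₊
  have floor_spec : ∀ u : ℝ, |u| < R → ∃ i : Fin n, (i : ℝ) * r ≤ u + R ∧ u + R ≤ i * r + r := by
    intro u hu
    obtain ⟨h1, h2⟩ := abs_lt.1 hu
    have h0 : 0 ≤ (u + R) / r := div_nonneg (by linarith) hr.le
    have hlt : ⌊(u + R) / r⌋₊ < n := by
      rw [Nat.floor_lt h0]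
      refine lt_of_lt_of_le ?_ (Nat.le_ceil _)
      gcongr
      linarith
    refine ⟨⟨_, hlt⟩, ?_, ?_⟩
    · exact (le_div_iff₀ hr).1 (Nat.floor_le h0)
    · have := (div_lt_iff₀ hr).1 (Nat.lt_floor_add_one ((u + R) / r))
      push_cast at this ⊢
      linarith
  refine ⟨fun m => (x.re - R + (finProdFinEquiv.symm m).1 * r,
    x.im - R + (finProdFinEquiv.symm m).2 * r), ?_⟩
  rintro z ⟨hz, -⟩
  rw [Metric.mem_ball, dist_eq_norm] at hz
  obtain ⟨i, hi1, hi2⟩ := floor_spec (z - x).re ((Complex.abs_re_le_norm _).trans_lt hz)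
  obtain ⟨j, hj1, hj2⟩ := floor_spec (z - x).im ((Complex.abs_im_le_norm _).trans_lt hz)
  simp only [Complex.sub_re, Complex.sub_im] at hi1 hi2 hj1 hj2
  refine mem_iUnion.2 ⟨finProdFinEquiv (i, j), ?_⟩
  simp only [closedSquare, Equiv.symm_apply_apply, mem_ofPred_eq, mem_Icc]
  refine ⟨⟨?_, ?_⟩, ?_, ?_⟩ <;> linarith

theorem sqCoverNum_ball_le (F : Set ℂ) (x : ℂ) {r R : ℝ} (hr : 0 < r) (hrR : r < R) :
    (sqCoverNum (Metric.ball x R ∩ F) r : ℝ) ≤ 9 * (R / r) ^ (2 : ℝ) := by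
  have hR := hr.trans hrR
  have h1 : sqCoverNum (Metric.ball x R ∩ F) r ≤ ⌈2 * R / r⌉₊ * ⌈2 * R / r⌉₊ :=
    Nat.sInf_le (exists_cover_ball x hr F)
  have h2 : (⌈2 * R / r⌉₊ : ℝ) ≤ 3 * (R / r) := by
    have h3 := Nat.ceil_lt_add_one (show 0 ≤ 2 * R / r by positivity)
    have h4 : 1 < R / r := (one_lt_div hr).2 hrR
    rw [mul_div_assoc] at h3 ⊢
    linarith
  calc (sqCoverNum (Metric.ball x R ∩ F) r : ℝ)
      ≤ (⌈2 * R / r⌉₊ : ℝ) * ⌈2 * R / r⌉₊ := by exact_mod_cast h1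
    _ ≤ (3 * (R / r)) * (3 * (R / r)) := by gcongr
    _ = 9 * (R / r) ^ (2 : ℝ) := by rw [Real.rpow_two]; ring

theorem card_le_sqCoverNum_ball {ι : Type*} [Fintype ι] {F : Set ℂ} {x : ℂ} {r R : ℝ}
    (hr : 0 < r) (z : ι → ℂ) (hz : ∀ a, z a ∈ Metric.ball x R ∩ F)
    (hsep : ∀ a b, |(z a).re - (z b).re| ≤ r → |(z a).im - (z b).im| ≤ r → a = b) :
    Fintype.card ι ≤ sqCoverNum (Metric.ball x R ∩ F) r := by
  refine le_csInf ⟨_, exists_cover_ball x hr F⟩ ?_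
  rintro n ⟨c, hc⟩
  choose f hf using fun a => mem_iUnion.1 (hc (hz a))
  have hinj : Function.Injective f := by
    intro a b hab
    have ha := hf a
    have hb := hf b
    rw [← hab] at hb
    obtain ⟨⟨_, _⟩, _, _⟩ := ha
    obtain ⟨⟨_, _⟩, _, _⟩ := hb
    apply hsep <;> rw [abs_le] <;> constructor <;> linarith
  simpa using Fintype.card_le_of_injective f hinj

theorem rpow_neg_sub_rpow_neg_ge {q t t' A : ℝ} (hq : 0 < q) (ht : 0 < t) (htt : t + 1 ≤ t')
    (hA : t' ≤ A) : q * A ^ (-q) / A ≤ t ^ (-q) - t' ^ (-q) := by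
  have ht' : 0 < t' := by linarith
  have hA0 : 0 < A := by linarith
  have hlog : 1 / A ≤ Real.log (t' / t) := by
    have h1 := Real.one_sub_inv_le_log_of_pos (div_pos ht' ht)
    have h2 : 1 / A ≤ 1 / t' := one_div_le_one_div_of_le ht' hA
    have h3 : 1 / t' ≤ 1 - (t' / t)⁻¹ := by
      rw [inv_div, one_sub_div ht'.ne']
      gcongr
      linarith
    linarith
  have hpow : 1 + q * (1 / A) ≤ (t' / t) ^ q := by
    rw [Real.rpow_def_of_pos (div_pos ht' ht)]
    have h1 := Real.add_one_le_exp (Real.log (t' / t) * q)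
    have h2 := mul_le_mul_of_nonneg_left hlog hq.le
    linarith
  have hmul : t ^ (-q) = t' ^ (-q) * (t' / t) ^ q := by
    rw [Real.div_rpow ht'.le ht.le, Real.rpow_neg ht'.le, Real.rpow_neg ht.le]
    have := (Real.rpow_pos_of_pos ht' q).ne'
    field_simp
  have hmono : A ^ (-q) ≤ t' ^ (-q) :=
    Real.rpow_le_rpow_of_nonpos ht' hA (by linarith)
  have hA' : 0 < A ^ (-q) := Real.rpow_pos_of_pos hA0 _
  calc q * A ^ (-q) / A = A ^ (-q) * (q * (1 / A)) := by ring
    _ ≤ t' ^ (-q) * ((t' / t) ^ q - 1) :=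
        mul_le_mul hmono (by linarith) (by positivity) (hA'.le.trans hmono)
    _ = t ^ (-q) - t' ^ (-q) := by rw [hmul]; ring

theorem exists_winding_point {p x : ℝ} (hp : 0 < p) {k : ℕ} (hx : 0 ≤ x)
    (hx' : x ≤ (2 * Real.pi * (k + 1)) ^ (-p) / 2) :
    ∃ t ∈ Icc (2 * Real.pi * k + Real.pi / 3) (2 * Real.pi * k + Real.pi / 2),
      t ^ (-p) * Real.cos t = x ∧ 0 ≤ Real.cos t ∧ 1 / 2 ≤ Real.sin t := by
  have hpi := Real.pi_pos
  have hk : 0 ≤ 2 * Real.pi * (k : ℝ) := by positivity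
  have hcos : ∀ u : ℝ, Real.cos (2 * Real.pi * k + u) = Real.cos u := by
    intro u
    rw [add_comm, mul_comm]
    exact Real.cos_add_nat_mul_two_pi u k
  have hsin : ∀ u : ℝ, Real.sin (2 * Real.pi * k + u) = Real.sin u := by
    intro u
    rw [add_comm, mul_comm]
    exact Real.sin_add_nat_mul_two_pi u k
  have hcont : ContinuousOn (fun t : ℝ => t ^ (-p) * Real.cos t)
      (Icc (2 * Real.pi * k + Real.pi / 3) (2 * Real.pi * k + Real.pi / 2)) := by
    refine ContinuousOn.mul ?_ Real.continuous_cos.continuousOn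
    refine continuousOn_id.rpow_const fun t ht => Or.inl ?_
    have := ht.1
    simp only [id]
    linarith
  have hivt := intermediate_value_Icc' (by linarith) hcont
  obtain ⟨t, ht, htx⟩ := hivt (show x ∈ _ by
    simp only [hcos, Real.cos_pi_div_two, Real.cos_pi_div_three, mul_zero, mem_Icc]
    refine ⟨hx, hx'.trans ?_⟩
    rw [mul_one_div]
    gcongr ?_ / 2
    exact Real.rpow_le_rpow_of_nonpos (by linarith) (by linarith) (by linarith))
  refine ⟨t, ht, htx, ?_, ?_⟩
  · have := hcos (t - 2 * Real.pi * k)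
    rw [add_sub_cancel] at this
    rw [this]
    exact Real.cos_nonneg_of_mem_Icc ⟨by linarith [ht.1], by linarith [ht.2]⟩
  · have := hsin (t - 2 * Real.pi * k)
    rw [add_sub_cancel] at this
    rw [this, ← Real.sin_pi_div_six]
    exact Real.sin_le_sin_of_le_of_le_pi_div_two (by linarith) (by linarith [ht.2])
      (by linarith [ht.1])

theorem winding_gap {p q t t' A : ℝ} (hp : 0 < p) (hq : 0 < q) (ht : 0 < t) (htt : t + 1 ≤ t')
    (hA : t' ≤ A) (hx : t ^ (-p) * Real.cos t = t' ^ (-p) * Real.cos t')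
    (hc : 0 ≤ Real.cos t) (hs : 1 / 2 ≤ Real.sin t) :
    q * A ^ (-q) / A / 2 ≤ t ^ (-q) * Real.sin t - t' ^ (-q) * Real.sin t' := by
  have ht' : 0 < t' := by linarith
  have hgap := rpow_neg_sub_rpow_neg_ge hq ht htt hA
  have hmono : t' ^ (-p) ≤ t ^ (-p) :=
    Real.rpow_le_rpow_of_nonpos ht (by linarith) (by linarith)
  have hp' : 0 < t' ^ (-p) := Real.rpow_pos_of_pos ht' _
  have hcc : Real.cos t ≤ Real.cos t' := by
    refine le_of_mul_le_mul_left ?_ hp'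
    rw [← hx]
    gcongr
  have hss : Real.sin t' ≤ Real.sin t := by
    refine abs_le_of_sq_le_sq' ?_ (by linarith) |>.2
    nlinarith [Real.sin_sq_add_cos_sq t, Real.sin_sq_add_cos_sq t']
  have hq' : 0 < t' ^ (-q) := Real.rpow_pos_of_pos ht' _
  have hA0 : 0 < A := by linarith
  have hpos : 0 ≤ q * A ^ (-q) / A := by positivity
  nlinarith [mul_le_mul_of_nonneg_left hss hq'.le,
    mul_le_mul_of_nonneg_left hs (hpos.trans hgap)]

theorem exists_sq_le_sqCoverNum_spiral {p q : ℝ} (hp : 0 < p) (hpq : p ≤ q) :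
    ∃ L : ℝ, 0 < L ∧ ∀ N : ℕ, 1 ≤ N → ∃ r R : ℝ, 0 < r ∧ r < R ∧ R / r = L * N ∧
      ∃ x ∈ spiral p q, (N : ℝ) ^ 2 ≤ sqCoverNum (Metric.ball x R ∩ spiral p q) r := by
  have hq : 0 < q := hp.trans_le hpq
  have hpi := Real.pi_gt_three
  have hpi' := Real.pi_lt_four
  obtain ⟨c, hc0, hc4, hcq⟩ : ∃ c : ℝ, 0 < c ∧ c ≤ 1 / 4 ∧ c < q / (8 * Real.pi) :=
    ⟨min (1 / 4) (q / 32), by positivity, min_le_left _ _,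
      (min_le_right _ _).trans_lt (by gcongr; linarith)⟩
  have h2q : 1 ≤ (2 : ℝ) ^ q := Real.one_le_rpow (by norm_num) hq.le
  refine ⟨2 * 2 ^ q / c, by positivity, fun N hN => ?_⟩
  have hN1 : (1 : ℝ) ≤ N := by exact_mod_cast hN
  have hN0 : (0 : ℝ) < N := by linarith
  set A : ℝ := 4 * Real.pi * N with hA
  have hA1 : 1 ≤ A := by nlinarith
  have hA0 : 0 < A := by linarith
  set a : ℝ := A ^ (-q) with ha
  have ha0 : 0 < a := Real.rpow_pos_of_pos hA0 _
  set r : ℝ := c * a / N with hr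
  have hr0 : 0 < r := by positivity
  have hrN : r * N = c * a := by rw [hr]; field_simp
  have hrR : r < 2 * 2 ^ q * a := by nlinarith
  have hrgap : r < q * A ^ (-q) / A / 2 := by
    have : q * A ^ (-q) / A / 2 = q / (8 * Real.pi) * a / N := by
      rw [← ha, hA]
      field_simp
      ring
    rw [this, hr]
    gcongr
  have hpoint : ∀ b : Fin N × Fin N, ∃ t ∈ Icc (2 * Real.pi * (N + b.1 : ℕ) + Real.pi / 3)
      (2 * Real.pi * (N + b.1 : ℕ) + Real.pi / 2),
      t ^ (-p) * Real.cos t = 2 * r * b.2 ∧ 0 ≤ Real.cos t ∧ 1 / 2 ≤ Real.sin t := by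
    rintro ⟨i, j⟩
    refine exists_winding_point hp (by positivity) ?_
    have hj : (j : ℝ) ≤ N := by exact_mod_cast j.2.le
    have hi : (i : ℝ) + 1 ≤ N := by exact_mod_cast i.2
    calc 2 * r * (j : ℝ) ≤ 2 * r * N := by gcongr
      _ = 2 * c * a := by linarith
      _ ≤ a / 2 := by nlinarith
      _ ≤ A ^ (-p) / 2 := by
          gcongr ?_ / 2
          exact Real.rpow_le_rpow_of_exponent_le hA1 (by linarith)
      _ ≤ _ := by
          gcongr ?_ / 2
          refine Real.rpow_le_rpow_of_nonpos (by positivity) ?_ (by linarith)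
          push_cast
          nlinarith
  choose t ht htx htc hts using hpoint
  have htlow : ∀ b, 2 * Real.pi * N ≤ t b := by
    intro b
    have h := (ht b).1
    push_cast at h
    have : 0 ≤ 2 * Real.pi * (b.1 : ℝ) := by positivity
    linarith
  have htup : ∀ b, t b ≤ A := by
    intro b
    have h := (ht b).2
    push_cast at h
    have hi : (b.1 : ℝ) + 1 ≤ N := by exact_mod_cast b.1.2
    nlinarith
  have h2piN : 6 < 2 * Real.pi * N := by nlinarith
  have ht0 : ∀ b, 0 < t b := fun b => by linarith [htlow b]
  have hadd : ∀ b b', b.1 < b'.1 → t b + 1 ≤ t b' := by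
    intro b b' hbb
    have h := (ht b).2
    have h' := (ht b').1
    push_cast at h h'
    have hi : (b.1 : ℝ) + 1 ≤ b'.1 := by exact_mod_cast hbb
    nlinarith
  have hgap : ∀ b b', b.1 < b'.1 → b.2 = b'.2 →
      r < t b ^ (-q) * Real.sin (t b) - t b' ^ (-q) * Real.sin (t b') := by
    intro b b' hbb hj
    refine hrgap.trans_le (winding_gap hp hq (ht0 b) (hadd b b' hbb) (htup b') ?_ (htc b) (hts b))
    rw [htx, htx, hj]
  set z : Fin N × Fin N → ℂ := fun b =>
    (t b ^ (-p) * Real.cos (t b) : ℝ) + (t b ^ (-q) * Real.sin (t b) : ℝ) * Complex.I with hz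
  have hzF : ∀ b, z b ∈ spiral p q := fun b => ⟨t b, by linarith [htlow b], rfl⟩
  have hre : ∀ b, (z b).re = 2 * r * b.2 := by
    intro b
    simp [hz, -Complex.ofReal_mul, htx]
  have him : ∀ b, (z b).im = t b ^ (-q) * Real.sin (t b) := by
    intro b
    simp [hz, -Complex.ofReal_mul]
  have hre0 : ∀ b, 0 ≤ (z b).re ∧ (z b).re ≤ a / 2 := by
    intro b
    rw [hre]
    have hj : (b.2 : ℝ) ≤ N := by exact_mod_cast b.2.2.le
    refine ⟨by positivity, ?_⟩
    nlinarith [mul_le_mul_of_nonneg_left hj hr0.le]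
  have him0 : ∀ b, 0 ≤ (z b).im ∧ (z b).im ≤ 2 ^ q * a := by
    intro b
    rw [him]
    have hpos : 0 < t b ^ (-q) := Real.rpow_pos_of_pos (ht0 b) _
    have hle : t b ^ (-q) ≤ 2 ^ q * a := by
      refine (Real.rpow_le_rpow_of_nonpos (by linarith) (htlow b) (by linarith)).trans_eq ?_
      have : 2 * Real.pi * N = A / 2 := by rw [hA]; ring
      rw [this, Real.div_rpow hA0.le (by norm_num), Real.rpow_neg (by norm_num : (0 : ℝ) ≤ 2), ← ha]
      field_simp
    have h12 := hts b
    exact ⟨by positivity, (mul_le_of_le_one_right hpos.le (Real.sin_le_one _)).trans hle⟩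
  let b₀ : Fin N × Fin N := (⟨0, hN⟩, ⟨0, hN⟩)
  refine ⟨r, 2 * 2 ^ q * a, hr0, hrR, by rw [hr]; field_simp, z b₀, hzF b₀, ?_⟩
  have hcard := card_le_sqCoverNum_ball (F := spiral p q) (x := z b₀) (R := 2 * 2 ^ q * a) hr0 z
    (fun b => ⟨?_, hzF b⟩) ?_
  · rw [Fintype.card_prod, Fintype.card_fin] at hcard
    rw [sq]
    exact_mod_cast hcard
  · rw [Metric.mem_ball, dist_eq_norm]
    refine (Complex.norm_le_abs_re_add_abs_im _).trans_lt ?_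
    have h1 : |(z b - z b₀).re| ≤ a / 2 := by
      rw [Complex.sub_re, abs_le]
      constructor <;> linarith [hre0 b, hre0 b₀]
    have h2 : |(z b - z b₀).im| ≤ 2 ^ q * a := by
      rw [Complex.sub_im, abs_le]
      constructor <;> linarith [him0 b, him0 b₀]
    nlinarith
  · intro b b' h1 h2
    have hj : b.2 = b'.2 := by
      by_contra hne
      rw [hre, hre, ← mul_sub, abs_mul, abs_of_pos (by positivity)] at h1
      have h3 : (1 : ℝ) ≤ |(b.2 : ℝ) - b'.2| := by
        have : (1 : ℤ) ≤ |(b.2 : ℤ) - b'.2| := by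
          refine Int.one_le_abs (sub_ne_zero.2 ?_)
          exact_mod_cast fun h => hne (Fin.ext h)
        exact_mod_cast this
      nlinarith
    rw [him, him] at h2
    refine Prod.ext ?_ hj
    rcases lt_trichotomy b.1 b'.1 with h | h | h
    · have := hgap b b' h hj
      linarith [(abs_le.1 h2).2]
    · exact h
    · have := hgap b' b h hj.symm
      linarith [(abs_le.1 h2).1]

theorem two_le_of_sq_le_mul_rpow {K α : ℝ}
    (h : ∀ N : ℕ, 1 ≤ N → (N : ℝ) ^ 2 ≤ K * (N : ℝ) ^ α) : 2 ≤ α := by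
  by_contra! hα
  have htend := (tendsto_rpow_atTop (sub_pos.2 hα)).comp tendsto_natCast_atTop_atTop
  obtain ⟨N, hNK, hN⟩ :=
    ((htend.eventually_gt_atTop K).and (Filter.eventually_ge_atTop 1)).exists
  have hN0 : (0 : ℝ) < N := by exact_mod_cast hN
  have h1 := h N hN
  rw [Function.comp_apply, Real.rpow_sub hN0, Real.rpow_two,
    lt_div_iff₀ (Real.rpow_pos_of_pos hN0 _)] at hNK
  linarith

theorem assouadDim_spiral (p q : ℝ) (hp : 0 < p) (hpq : p ≤ q) :
    assouadDim (spiral p q) = 2 := by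
  refine IsLeast.csInf_eq ⟨⟨by norm_num, 9, by norm_num,
    fun r R hr hrR x _ => sqCoverNum_ball_le _ x hr hrR⟩, ?_⟩
  rintro α ⟨-, C, -, hC⟩
  obtain ⟨L, hL, hcover⟩ := exists_sq_le_sqCoverNum_spiral hp hpq
  refine two_le_of_sq_le_mul_rpow (K := C * L ^ α) fun N hN => ?_
  obtain ⟨r, R, hr, hrR, hratio, x, hx, hle⟩ := hcover N hN
  have := hle.trans (hC r R hr hrR x hx)
  rwa [hratio, Real.mul_rpow hL.le (Nat.cast_nonneg N), ← mul_assoc] at this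
end
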